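/- Let μ be a probability measure on ℝ × ℤ/2ℤ with everywhere positive characteristic function such that μ̂(s,0) = exp(−σs²) for some σ ≥ 0 and μ̂(s,1) = exp(−P(s)) for all s ∈ ℝ, where P is a polynomial of degree at most 2 with real coefficients. Then P(s) = σ's² + c for some σ' ≥ 0 and constant c ≥ 0; that is, μ̂(s,1) = κ·exp(−σ's²) with 0 < κ ≤ 1, and μ belongs to the class Θ(ℝ × ℤ/2ℤ). -/

import Mathlib

open MeasureTheory

/-- The pairing `((t,k),(s,l)) = e^{ist}·(−1)^{kl}` between `ℝ × ℤ/2ℤ` and its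
character group (identified with `ℝ × ℤ/2ℤ`). -/
noncomputable def pairing (x y : ℝ × ZMod 2) : ℂ :=
  Complex.exp ((y.1 : ℂ) * (x.1 : ℂ) * Complex.I) * (-1 : ℂ) ^ (x.2 * y.2).val

/-- The characteristic function of a measure on `ℝ × ℤ/2ℤ`. -/
noncomputable def charFun2 (μ : Measure (ℝ × ZMod 2)) (y : ℝ × ZMod 2) : ℂ :=
  ∫ x, pairing x y ∂μ


/-- The class `Θ(ℝ × ℤ/2ℤ)` of distributions from the paper. -/
def IsThetaClass (μ : Measure (ℝ × ZMod 2)) : Prop :=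
  ∃ σ σ' β β' κ : ℝ,
    (∀ s : ℝ, charFun2 μ (s, 0) =
      Complex.exp (-(σ : ℂ) * s ^ 2 + (β : ℂ) * s * Complex.I)) ∧
    (∀ s : ℝ, charFun2 μ (s, 1) =
      (κ : ℂ) * Complex.exp (-(σ' : ℂ) * s ^ 2 + (β' : ℂ) * s * Complex.I)) ∧
    ((0 < σ' ∧ σ' < σ ∧ 0 < |κ| ∧
        |κ| ≤ Real.sqrt (σ' / σ) * Real.exp (-(β - β') ^ 2 / (4 * (σ - σ')))) ∨
      (σ = σ' ∧ 0 ≤ σ ∧ β = β' ∧ |κ| ≤ 1))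

open ProbabilityTheory
open scoped NNReal ENNReal

/-- The restriction of `μ` to the fibre `ℝ × {k}`, as a measure on `ℝ`. -/
noncomputable def fibreMeasure (μ : Measure (ℝ × ZMod 2)) (k : ZMod 2) : Measure ℝ :=
  (μ.restrict (Prod.snd ⁻¹' {k})).map Prod.fst

instance (μ : Measure (ℝ × ZMod 2)) [IsFiniteMeasure μ] (k : ZMod 2) :
    IsFiniteMeasure (fibreMeasure μ k) := by
  unfold fibreMeasure; infer_instance

lemma measurable_pairing (y : ℝ × ZMod 2) : Measurable fun x ↦ pairing x y := by
  unfold pairing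
  have : Measurable fun x : ℝ × ZMod 2 ↦ (-1 : ℂ) ^ (x.2 * y.2).val :=
    (measurable_of_countable fun k : ZMod 2 ↦ (-1 : ℂ) ^ (k * y.2).val).comp measurable_snd
  fun_prop

lemma norm_pairing (x y : ℝ × ZMod 2) : ‖pairing x y‖ = 1 := by
  rw [pairing, norm_mul, norm_pow, norm_neg, norm_one, one_pow, mul_one]
  exact_mod_cast Complex.norm_exp_ofReal_mul_I (y.1 * x.1)

lemma integrable_pairing (μ : Measure (ℝ × ZMod 2)) [IsFiniteMeasure μ] (y : ℝ × ZMod 2) :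
    Integrable (fun x ↦ pairing x y) μ :=
  .of_bound (measurable_pairing y).aestronglyMeasurable 1 (.of_forall fun x ↦ (norm_pairing x y).le)

lemma norm_charFun2_le_one (μ : Measure (ℝ × ZMod 2)) [IsProbabilityMeasure μ] (y : ℝ × ZMod 2) :
    ‖charFun2 μ y‖ ≤ 1 := by
  simpa [charFun2] using
    norm_integral_le_of_norm_le_const (μ := μ) (.of_forall fun x ↦ (norm_pairing x y).le)

lemma setIntegral_pairing (μ : Measure (ℝ × ZMod 2)) (k : ZMod 2) (y : ℝ × ZMod 2) :
    ∫ x in Prod.snd ⁻¹' {k}, pairing x y ∂μ =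
      (-1 : ℂ) ^ (k * y.2).val * charFun (fibreMeasure μ k) y.1 := by
  rw [charFun_apply_real, fibreMeasure, integral_map (by fun_prop) (by fun_prop),
    ← integral_const_mul]
  refine setIntegral_congr_fun (measurable_snd (measurableSet_singleton k)) fun x hx ↦ ?_
  have hx : x.2 = k := hx
  simp only [pairing, hx, mul_comm]

lemma charFun2_eq (μ : Measure (ℝ × ZMod 2)) [IsFiniteMeasure μ] (y : ℝ × ZMod 2) :
    charFun2 μ y = charFun (fibreMeasure μ 0) y.1 +
      (-1 : ℂ) ^ y.2.val * charFun (fibreMeasure μ 1) y.1 := by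
  have hc : (Prod.snd ⁻¹' {0} : Set (ℝ × ZMod 2))ᶜ = Prod.snd ⁻¹' {1} := by
    ext ⟨t, k⟩
    have : ∀ k : ZMod 2, k ≠ 0 ↔ k = 1 := by decide
    simpa using this k
  rw [charFun2, ← integral_add_compl (s := Prod.snd ⁻¹' {0})
    (measurable_snd (measurableSet_singleton 0)) (integrable_pairing μ y), hc,
    setIntegral_pairing, setIntegral_pairing]
  simp

lemma charFun2_zero (μ : Measure (ℝ × ZMod 2)) [IsFiniteMeasure μ] (s : ℝ) :
    charFun2 μ (s, 0) = charFun (fibreMeasure μ 0) s + charFun (fibreMeasure μ 1) s := by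
  simp [charFun2_eq]

lemma charFun2_one (μ : Measure (ℝ × ZMod 2)) [IsFiniteMeasure μ] (s : ℝ) :
    charFun2 μ (s, 1) = charFun (fibreMeasure μ 0) s - charFun (fibreMeasure μ 1) s := by
  simp [charFun2_eq, ZMod.val_one, sub_eq_add_neg]

lemma charFun2_neg_one (μ : Measure (ℝ × ZMod 2)) [IsFiniteMeasure μ] (s : ℝ) :
    charFun2 μ (-s, 1) = (starRingEnd ℂ) (charFun2 μ (s, 1)) := by
  simp [charFun2_one]

lemma charFun_add_measure (μ ν : Measure ℝ) [IsFiniteMeasure μ] [IsFiniteMeasure ν] (t : ℝ) :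
    charFun (μ + ν) t = charFun μ t + charFun ν t := by
  have (ρ : Measure ℝ) [IsFiniteMeasure ρ] :
      Integrable (fun x : ℝ ↦ Complex.exp (t * x * Complex.I)) ρ := by
    refine .of_bound (by fun_prop) 1 (.of_forall fun x ↦ ?_)
    exact_mod_cast (Complex.norm_exp_ofReal_mul_I (t * x)).le
  simp only [charFun_apply_real]
  exact integral_add_measure (this μ) (this ν)

lemma charFun_smul_measure (c : ℝ≥0) (μ : Measure ℝ) (t : ℝ) :
    charFun (c • μ) t = c * charFun μ t := by
  simp only [charFun_apply_real]
  rw [integral_smul_nnreal_measure]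
  simp [NNReal.smul_def]

/-- Pointwise comparison of densities when a multiple of one centred Gaussian is dominated by
another. -/
lemma gaussianPDFReal_le_of_smul_le {κ v w : ℝ≥0} (hv : v ≠ 0) (hw : w ≠ 0)
    (h : κ • gaussianReal 0 v ≤ gaussianReal 0 w) (x : ℝ) :
    κ * gaussianPDFReal 0 v x ≤ gaussianPDFReal 0 w x := by
  have hae : (fun x ↦ (κ : ℝ≥0∞) * gaussianPDF 0 v x) ≤ᵐ[volume] gaussianPDF 0 w := by
    refine ae_le_of_forall_setLIntegral_le_of_sigmaFinite (by fun_prop) fun s _ _ ↦ ?_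
    rw [lintegral_const_mul _ (by fun_prop), ← gaussianReal_apply 0 hv, ← gaussianReal_apply 0 hw]
    exact h s
  have hcont (u : ℝ≥0) : Continuous (gaussianPDFReal 0 u) := by
    unfold gaussianPDFReal; fun_prop
  have hclosed : IsClosed {x | κ * gaussianPDFReal 0 v x ≤ gaussianPDFReal 0 w x} :=
    isClosed_le (continuous_const.mul (hcont v)) (hcont w)
  have hdense : Dense {x | κ * gaussianPDFReal 0 v x ≤ gaussianPDFReal 0 w x} := by
    refine Measure.dense_of_ae (μ := volume) ?_
    filter_upwards [hae] with x hx
    have := ENNReal.toReal_mono (by simp [gaussianPDF]) hx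
    simpa [toReal_gaussianPDF] using this
  have := hclosed.closure_eq ▸ hdense x
  exact this

lemma le_of_forall_mul_gaussianPDFReal_le {κ v w : ℝ≥0} (hκ : κ ≠ 0) (hv : v ≠ 0) (hw : w ≠ 0)
    (h : ∀ x, κ * gaussianPDFReal 0 v x ≤ gaussianPDFReal 0 w x) : v ≤ w := by
  by_contra! hwv
  have hw0 : (0 : ℝ) < w := by positivity
  have hv0 : (0 : ℝ) < v := by positivity
  have hκ0 : (0 : ℝ) < κ := by positivity
  have hd : 0 < 1 / (2 * (w : ℝ)) - 1 / (2 * v) := by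
    have : (w : ℝ) < v := hwv
    rw [sub_pos]
    gcongr
  set d := 1 / (2 * (w : ℝ)) - 1 / (2 * v) with hd_def
  set A := κ * (√(2 * Real.pi * v))⁻¹
  set B := (√(2 * Real.pi * w))⁻¹
  have hA0 : 0 < A := by positivity
  have hB0 : 0 < B := by positivity
  have key (x : ℝ) : A * (d * x ^ 2) ≤ B := by
    have hx := h x
    simp only [gaussianPDFReal, sub_zero] at hx
    have e : Real.exp (-x ^ 2 / (2 * v)) = Real.exp (d * x ^ 2) * Real.exp (-x ^ 2 / (2 * w)) := by
      rw [← Real.exp_add, hd_def]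
      congr 1
      ring
    rw [e, ← mul_assoc, ← mul_assoc] at hx
    have hx := le_of_mul_le_mul_right hx (Real.exp_pos _)
    refine le_trans ?_ hx
    gcongr
    linarith [Real.add_one_le_exp (d * x ^ 2)]
  have := key (√((B + 1) / (A * d)))
  rw [Real.sq_sqrt (by positivity)] at this
  have e : A * (d * ((B + 1) / (A * d))) = B + 1 := by field_simp
  linarith

lemma le_sqrt_of_forall_mul_gaussianPDFReal_le {κ v w : ℝ≥0} (hv : v ≠ 0) (hw : w ≠ 0)
    (h : ∀ x, κ * gaussianPDFReal 0 v x ≤ gaussianPDFReal 0 w x) :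
    (κ : ℝ) ≤ √((v : ℝ) / w) := by
  have hw0 : (0 : ℝ) < w := by positivity
  have hv0 : (0 : ℝ) < v := by positivity
  have h0 := h 0
  simp only [gaussianPDFReal, sub_zero, ne_eq, OfNat.ofNat_ne_zero, not_false_eq_true, zero_pow,
    neg_zero, zero_div, Real.exp_zero, mul_one] at h0
  rw [← div_eq_mul_inv, div_le_iff₀ (by positivity)] at h0
  refine h0.trans_eq ?_
  rw [mul_comm, ← div_eq_mul_inv, ← Real.sqrt_div (by positivity)]
  congr 1
  field_simp

lemma gaussianReal_smul_le {κ v w : ℝ≥0} (hκ : κ ≠ 0)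
    (h : κ • gaussianReal 0 v ≤ gaussianReal 0 w) :
    v = w ∨ (v ≠ 0 ∧ v < w ∧ (κ : ℝ) ≤ √((v : ℝ) / w)) := by
  rcases eq_or_ne w 0 with rfl | hw
  · left
    by_contra hv
    have := h {0}ᶜ
    have := nullSingletonClass_gaussianReal (μ := 0) hv
    have h1 : gaussianReal 0 v {0}ᶜ = 1 := by
      rw [prob_compl_eq_one_iff (measurableSet_singleton 0)]
      exact measure_singleton 0
    simp_all
  rcases eq_or_ne v 0 with rfl | hv
  · have := h {0}
    have := nullSingletonClass_gaussianReal (μ := 0) hw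
    simp_all
  have hpdf := gaussianPDFReal_le_of_smul_le hv hw h
  rcases (le_of_forall_mul_gaussianPDFReal_le hκ hv hw hpdf).eq_or_lt with hvw | hvw
  · exact .inl hvw
  · exact .inr ⟨hv, hvw, le_sqrt_of_forall_mul_gaussianPDFReal_le hv hw hpdf⟩

lemma charFun_gaussianReal_two_mul (σ : ℝ≥0) (s : ℝ) :
    charFun (gaussianReal 0 (2 * σ)) s = Complex.exp (-(σ : ℂ) * s ^ 2) := by
  rw [charFun_gaussianReal]
  congr 1
  push_cast
  ring

/-- If the two slices of the characteristic function are those of a Gaussian and of a multiple of a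
Gaussian, then the multiple is dominated by the first Gaussian. -/
lemma smul_gaussianReal_le_of_charFun2 (μ : Measure (ℝ × ZMod 2)) [IsFiniteMeasure μ]
    {σ σ' κ : ℝ≥0}
    (h0 : ∀ s : ℝ, charFun2 μ (s, 0) = Complex.exp (-(σ : ℂ) * s ^ 2))
    (h1 : ∀ s : ℝ, charFun2 μ (s, 1) = (κ : ℂ) * Complex.exp (-(σ' : ℂ) * s ^ 2)) :
    κ • gaussianReal 0 (2 * σ') ≤ gaussianReal 0 (2 * σ) := by
  have hsum : fibreMeasure μ 0 + fibreMeasure μ 1 = gaussianReal 0 (2 * σ) := by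
    refine Measure.ext_of_charFun (funext fun s ↦ ?_)
    rw [charFun_add_measure, ← charFun2_zero, h0, charFun_gaussianReal_two_mul]
  have hdiff : κ • gaussianReal 0 (2 * σ') + fibreMeasure μ 1 = fibreMeasure μ 0 := by
    refine Measure.ext_of_charFun (funext fun s ↦ ?_)
    rw [charFun_add_measure, charFun_smul_measure, charFun_gaussianReal_two_mul, ← h1, charFun2_one,
      sub_add_cancel]
  rw [← hsum, ← hdiff, add_assoc]
  exact Measure.le_add_right le_rfl

lemma isThetaClass_of_charFun2 (μ : Measure (ℝ × ZMod 2)) [IsProbabilityMeasure μ]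
    {σ σ' κ : ℝ≥0} (hκ : κ ≠ 0) (hκ1 : κ ≤ 1)
    (h0 : ∀ s : ℝ, charFun2 μ (s, 0) = Complex.exp (-(σ : ℂ) * s ^ 2))
    (h1 : ∀ s : ℝ, charFun2 μ (s, 1) = (κ : ℂ) * Complex.exp (-(σ' : ℂ) * s ^ 2)) :
    IsThetaClass μ := by
  refine ⟨σ, σ', 0, 0, κ, fun s ↦ by simp [h0], fun s ↦ by simp [h1], ?_⟩
  have habs : |(κ : ℝ)| = κ := abs_of_nonneg κ.2
  rcases gaussianReal_smul_le hκ (smul_gaussianReal_le_of_charFun2 μ h0 h1) with h | ⟨hv, hlt, hle⟩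
  · right
    have : σ' = σ := by simpa using h
    exact ⟨by rw [this], σ.2, rfl, by rw [habs]; exact_mod_cast hκ1⟩
  · left
    have hv : σ' ≠ 0 := by simpa using hv
    refine ⟨by positivity, ?_, by positivity, ?_⟩
    · exact_mod_cast lt_of_mul_lt_mul_left hlt zero_le_two
    · push_cast at hle
      rw [mul_div_mul_left _ _ two_ne_zero] at hle
      simpa [habs] using hle

/-- An even polynomial of degree at most two that is nonnegative on `ℝ` has the form
`a * s ^ 2 + c` with `a, c ≥ 0`. -/
lemma exists_eval_eq_of_even_of_nonneg {P : Polynomial ℝ} (hdeg : P.natDegree ≤ 2)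
    (heven : ∀ s, P.eval (-s) = P.eval s) (hnonneg : ∀ s, 0 ≤ P.eval s) :
    ∃ a c : ℝ, 0 ≤ a ∧ 0 ≤ c ∧ ∀ s : ℝ, P.eval s = a * s ^ 2 + c := by
  have hP (s : ℝ) : P.eval s = P.coeff 0 + P.coeff 1 * s + P.coeff 2 * s ^ 2 := by
    rw [Polynomial.eval_eq_sum_range' (n := 3) (by omega)]
    simp [Finset.sum_range_succ]
  have hlin : P.coeff 1 = 0 := by
    have := heven 1
    rw [hP, hP] at this
    linarith
  have hP' (s : ℝ) : P.eval s = P.coeff 2 * s ^ 2 + P.coeff 0 := by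
    rw [hP, hlin]
    ring
  have hc : 0 ≤ P.coeff 0 := by simpa [hP'] using hnonneg 0
  refine ⟨P.coeff 2, P.coeff 0, ?_, hc, hP'⟩
  by_contra! ha
  have h := hnonneg (√((P.coeff 0 + 1) / -P.coeff 2))
  have ha' : 0 < -P.coeff 2 := by linarith
  rw [hP', Real.sq_sqrt (by positivity)] at h
  have e : P.coeff 2 * ((P.coeff 0 + 1) / -P.coeff 2) = -(P.coeff 0 + 1) := by
    field_simp [ha.ne]
  linarith

theorem stmt_19 (μ : Measure (ℝ × ZMod 2)) [IsProbabilityMeasure μ]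
    (hpos : ∀ y : ℝ × ZMod 2, ∃ r : ℝ, 0 < r ∧ charFun2 μ y = (r : ℂ))
    (σ : ℝ) (hσ : 0 ≤ σ) (P : Polynomial ℝ) (hdeg : P.natDegree ≤ 2)
    (h0 : ∀ s : ℝ, charFun2 μ (s, 0) = Complex.exp (-(σ : ℂ) * s ^ 2))
    (h1 : ∀ s : ℝ, charFun2 μ (s, 1) = Complex.exp (-((P.eval s : ℝ) : ℂ))) :
    ∃ σ' c : ℝ, 0 ≤ σ' ∧ 0 ≤ c ∧ (∀ s : ℝ, P.eval s = σ' * s ^ 2 + c) ∧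
      (∀ s : ℝ, charFun2 μ (s, 1) =
        (Real.exp (-c) : ℂ) * Complex.exp (-(σ' : ℂ) * s ^ 2)) ∧
      IsThetaClass μ := by
  have h1' (s : ℝ) : charFun2 μ (s, 1) = (Real.exp (-P.eval s) : ℝ) := by
    rw [h1]; push_cast; rfl
  have heven (s : ℝ) : P.eval (-s) = P.eval s := by
    have := charFun2_neg_one μ s
    rw [h1', h1', Complex.conj_ofReal] at this
    exact neg_injective (Real.exp_injective (Complex.ofReal_injective this))
  have hnonneg (s : ℝ) : 0 ≤ P.eval s := by
    have := norm_charFun2_le_one μ (s, 1)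
    rw [h1', Complex.norm_real, Real.norm_eq_abs, Real.abs_exp] at this
    simpa using this
  obtain ⟨a, c, ha, hc, hP⟩ := exists_eval_eq_of_even_of_nonneg hdeg heven hnonneg
  have h1c (s : ℝ) : charFun2 μ (s, 1) =
      (Real.exp (-c) : ℂ) * Complex.exp (-(a : ℂ) * s ^ 2) := by
    rw [h1, hP]
    push_cast
    rw [← Complex.exp_add]
    congr 1
    ring
  refine ⟨a, c, ha, hc, hP, h1c, ?_⟩
  refine isThetaClass_of_charFun2 μ (σ := ⟨σ, hσ⟩) (σ' := ⟨a, ha⟩)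
    (κ := ⟨Real.exp (-c), (Real.exp_pos _).le⟩) ?_ ?_ h0 h1c
  · exact fun h ↦ (Real.exp_pos (-c)).ne' (congrArg NNReal.toReal h)
  · exact Real.exp_le_one_iff.2 (by linarith)
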